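/- arXiv:1109.0241 — 5 statements merged into one kernel-verified Lean document; each statement's English description precedes it below -/
import Mathlib

section
/- Let m ≥ 2 and ℓ ≥ 1 be integers with ℓ not divisible by k² for any integer k ≥ 2, and let n = m²ℓ. Set u = exp(2πi/(mℓ)), β = (m(mℓ−1)) mod 2, and γ = exp(iπβ/(mℓ)). Then for all nonzero complex parameters t_0, t_1, …, t_{m−2}, the point x ∈ ℂⁿ defined by x_{km+j} = u^k · t_0 t_1 ⋯ t_j for 0 ≤ j ≤ m−2 and x_{km+m−1} = γ · u^k · t_0^{−(m−1)} t_1^{−(m−2)} ⋯ t_{m−3}^{−2} t_{m−2}^{−1}, for each k = 0, 1, …, mℓ−1, is a cyclic n-root. -/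
/-- The `d`-th polynomial of the cyclic `n`-roots system evaluated at `x`
(only the coordinates `x 0, …, x (n-1)` are used):
`f_d(x) = Σ_{i=0}^{n-1} Π_{j=0}^{d-1} x_{(i+j) mod n}`. -/
noncomputable def cyclicF (n d : ℕ) (x : ℕ → ℂ) : ℂ :=
  ∑ i ∈ Finset.range n, ∏ j ∈ Finset.range d, x ((i + j) % n)

/-- `x` is a cyclic `n`-root: `f_d(x) = 0` for `d = 1, …, n-1` and
`x_0 x_1 ⋯ x_{n-1} = 1`. -/
def IsCyclicRoot (n : ℕ) (x : ℕ → ℂ) : Prop :=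
  (∀ d : ℕ, 1 ≤ d → d ≤ n - 1 → cyclicF n d x = 0) ∧
  ∏ i ∈ Finset.range n, x i = 1

/-- Splitting a product over `range (N * m)` into `N` consecutive blocks of length `m`. -/
theorem prod_range_mul_blocks {M : Type*} [CommMonoid M] (f : ℕ → M) (N m : ℕ) :
    ∏ i ∈ Finset.range (N * m), f i =
      ∏ k ∈ Finset.range N, ∏ j ∈ Finset.range m, f (k * m + j) := by
  induction N with
  | zero => simp
  | succ N ih => rw [Nat.succ_mul, Finset.prod_range_add, ih, Finset.prod_range_succ]

/-- A sequence with `f (i + m) = w * f i`, where `w ≠ 1` and `w ^ N = 1`, sums to zero over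
`N` consecutive blocks of length `m`. -/
theorem sum_range_eq_zero_of_quasiperiodic {f : ℕ → ℂ} {w : ℂ} {N m : ℕ}
    (hf : ∀ i, f (i + m) = w * f i) (hw : w ≠ 1) (hwN : w ^ N = 1) :
    ∑ i ∈ Finset.range (N * m), f i = 0 := by
  have shift : ∀ k i, f (k * m + i) = w ^ k * f i := by
    intro k i
    induction k with
    | zero => simp
    | succ k ih => rw [show (k + 1) * m + i = k * m + i + m by ring, hf, ih]; ring
  have blocks : ∀ K, ∑ i ∈ Finset.range (K * m), f i =
      (∑ k ∈ Finset.range K, w ^ k) * ∑ j ∈ Finset.range m, f j := by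
    intro K
    induction K with
    | zero => simp
    | succ K ih =>
      rw [Nat.succ_mul, Finset.sum_range_add, ih, Finset.sum_range_succ, add_mul]
      simp only [shift, Finset.mul_sum]
  rw [blocks, geom_sum_eq hw, hwN, sub_self, zero_div, zero_mul]

/-- If `y (i + m) = u * y i` with `u` a primitive `m * ℓ`-th root of unity and `y` nowhere zero,
then the sums of products of `d` consecutive terms vanish for `0 < d < m * ℓ * m`. -/
theorem sum_prod_consecutive_eq_zero {y : ℕ → ℂ} {u : ℂ} {m ℓ d : ℕ}
    (hu : IsPrimitiveRoot u (m * ℓ)) (hℓ : 0 < ℓ) (hy : ∀ i, y (i + m) = u * y i)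
    (hy0 : ∀ i, y i ≠ 0) (hd : 0 < d) (hdn : d < m * ℓ * m) :
    ∑ i ∈ Finset.range (m * ℓ * m), ∏ j ∈ Finset.range d, y (i + j) = 0 := by
  by_cases hdvd : m * ℓ ∣ d
  · obtain ⟨c, rfl⟩ := hdvd
    have hc : c < m := lt_of_mul_lt_mul_left hdn (Nat.zero_le _)
    have hc0 : 0 < c := Nat.pos_of_mul_pos_left hd
    have shift : ∀ k i, y (i + m * k) = u ^ k * y i := by
      intro k i
      induction k with
      | zero => simp
      | succ k ih => rw [show i + m * (k + 1) = i + m * k + m by ring, hy, ih]; ring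
    have step : ∀ i, ∏ j ∈ Finset.range (m * ℓ * c), y (i + 1 + j) =
        u ^ (ℓ * c) * ∏ j ∈ Finset.range (m * ℓ * c), y (i + j) := by
      intro i
      have h := Finset.prod_range_succ' (fun j => y (i + j)) (m * ℓ * c)
      rw [Finset.prod_range_succ, mul_assoc m ℓ c, shift, add_zero] at h
      apply mul_right_cancel₀ (hy0 i)
      rw [mul_assoc m ℓ c]
      simp only [add_assoc, add_comm 1]
      rw [← h]
      ring
    have hne : u ^ (ℓ * c) ≠ 1 := by
      rw [Ne, hu.pow_eq_one_iff_dvd]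
      intro h
      have h' : ℓ * m ∣ ℓ * c := by rwa [mul_comm ℓ m]
      exact absurd (Nat.le_of_dvd hc0 (Nat.dvd_of_mul_dvd_mul_left hℓ h')) (by omega)
    have h := sum_range_eq_zero_of_quasiperiodic (m := 1) (N := m * ℓ * m)
      (f := fun i => ∏ j ∈ Finset.range (m * ℓ * c), y (i + j)) step hne
      (by rw [pow_right_comm, pow_mul u (m * ℓ) m, hu.pow_eq_one, one_pow, one_pow])
    rwa [mul_one] at h
  · refine sum_range_eq_zero_of_quasiperiodic (w := u ^ d) (fun i => ?_) ?_ ?_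
    · have h : ∀ j, y (i + m + j) = u * y (i + j) := fun j => by rw [← hy]; congr 1; ring
      simp [h, Finset.prod_mul_distrib]
    · rwa [Ne, hu.pow_eq_one_iff_dvd]
    · rw [pow_right_comm, hu.pow_eq_one, one_pow]

/-- The product of the partial products `t 0 ⋯ t j`, `j < r`. -/
theorem prod_range_partial_prod {M : Type*} [CommMonoid M] (t : ℕ → M) (r : ℕ) :
    ∏ j ∈ Finset.range r, ∏ i ∈ Finset.range (j + 1), t i =
      ∏ i ∈ Finset.range r, t i ^ (r - i) := by
  induction r with
  | zero => simp
  | succ r ih =>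
    rw [Finset.prod_range_succ, ih, Finset.prod_range_succ, Finset.prod_range_succ, ← mul_assoc,
      ← Finset.prod_mul_distrib, Nat.add_sub_cancel_left, pow_one]
    congr 1
    refine Finset.prod_congr rfl fun i hi => ?_
    rw [← pow_succ, Nat.sub_add_comm (Finset.mem_range.mp hi).le]

/-- The normalisation of `γ`: it cancels the sign of the product of all powers of `u`. -/
theorem exp_pow_mul_exp_pow_eq_one {m N β : ℕ} (hN : 0 < N) (hβ : β = m * (N - 1) % 2) :
    (Complex.exp (2 * Real.pi * Complex.I / N) ^ m) ^ (∑ k ∈ Finset.range N, k) *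
      Complex.exp (Real.pi * Complex.I * β / N) ^ N = 1 := by
  have hN' : (N : ℂ) ≠ 0 := by exact_mod_cast hN.ne'
  obtain ⟨q, hq⟩ : ∃ q, m * (N - 1) + β = 2 * q := ⟨(m * (N - 1) + β) / 2, by omega⟩
  have hs : ((∑ k ∈ Finset.range N, k : ℕ) : ℂ) * 2 = N * (N - 1 : ℕ) := by
    exact_mod_cast Finset.sum_range_id_mul_two N
  have hqβ : (m : ℂ) * (N - 1 : ℕ) + β = 2 * q := by exact_mod_cast hq
  generalize (∑ k ∈ Finset.range N, k) = s at hs ⊢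
  rw [← Complex.exp_nat_mul, ← Complex.exp_nat_mul, ← Complex.exp_nat_mul, ← Complex.exp_add,
    ← Complex.exp_nat_mul_two_pi_mul_I q]
  congr 1
  field_simp
  linear_combination (m : ℂ) * hs + (N : ℂ) * hqβ

/-- Tropical version of Backelin's Lemma: for `n = m²ℓ` with `ℓ` squarefree,
the `(m-1)`-parameter monomial family is a family of cyclic `n`-roots. -/
theorem backelin_tropical
    (m ℓ : ℕ) (hm : 2 ≤ m) (hℓ : 1 ≤ ℓ)
    (hsqfree : ∀ k : ℕ, 2 ≤ k → ¬ (k ^ 2 ∣ ℓ))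
    (n : ℕ) (hn : n = m ^ 2 * ℓ)
    (u : ℂ) (hu : u = Complex.exp (2 * Real.pi * Complex.I / (m * ℓ)))
    (β : ℕ) (hβ : β = (m * (m * ℓ - 1)) % 2)
    (γ : ℂ) (hγ : γ = Complex.exp (Real.pi * Complex.I * β / (m * ℓ)))
    (t : ℕ → ℂ) (ht : ∀ j < m - 1, t j ≠ 0)
    (x : ℕ → ℂ)
    (hx1 : ∀ k < m * ℓ, ∀ j < m - 1,
      x (k * m + j) = u ^ k * ∏ i ∈ Finset.range (j + 1), t i)
    (hx2 : ∀ k < m * ℓ,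
      x (k * m + (m - 1)) =
        γ * u ^ k * ∏ i ∈ Finset.range (m - 1), ((t i)⁻¹) ^ (m - 1 - i)) :
    IsCyclicRoot n x := by
  subst hn
  have hN : 0 < m * ℓ := by positivity
  have hprim : IsPrimitiveRoot u (m * ℓ) := by
    rw [hu]
    exact_mod_cast Complex.isPrimitiveRoot_exp (m * ℓ) hN.ne'
  have hu0 : u ≠ 0 := hprim.ne_zero hN.ne'
  have hγ0 : γ ≠ 0 := hγ ▸ Complex.exp_ne_zero _
  have hx : ∀ k < m * ℓ, ∀ j < m, x (k * m + j) = u ^ k * x j := by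
    intro k hk j hj
    rcases Nat.lt_or_ge j (m - 1) with h | h
    · have h0 := hx1 0 hN j h
      rw [zero_mul, zero_add, pow_zero, one_mul] at h0
      rw [hx1 k hk j h, h0]
    · obtain rfl : j = m - 1 := by omega
      have h0 := hx2 0 hN
      rw [zero_mul, zero_add, pow_zero, mul_one] at h0
      rw [hx2 k hk, h0]
      ring
  have hx0 : ∀ j < m, x j ≠ 0 := by
    intro j hj
    rcases Nat.lt_or_ge j (m - 1) with h | h
    · have h0 := hx1 0 hN j h
      rw [zero_mul, zero_add, pow_zero, one_mul] at h0
      rw [h0, Finset.prod_ne_zero_iff]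
      intro i hi
      exact ht i (by have := Finset.mem_range.mp hi; omega)
    · obtain rfl : j = m - 1 := by omega
      have h0 := hx2 0 hN
      rw [zero_mul, zero_add, pow_zero, mul_one] at h0
      rw [h0]
      refine mul_ne_zero hγ0 (Finset.prod_ne_zero_iff.mpr fun i hi => ?_)
      exact pow_ne_zero _ (inv_ne_zero (ht i (Finset.mem_range.mp hi)))
  have hblock : ∏ j ∈ Finset.range m, x j = γ := by
    obtain ⟨r, rfl⟩ : ∃ r, m = r + 1 := ⟨m - 1, by omega⟩
    have h1 : ∀ j ∈ Finset.range r, x j = ∏ i ∈ Finset.range (j + 1), t i := fun j hj => by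
      simpa using hx1 0 hN j (by simpa using hj)
    have h2 : x r = γ * ∏ i ∈ Finset.range r, (t i)⁻¹ ^ (r - i) := by
      simpa using hx2 0 hN
    rw [Finset.prod_range_succ, Finset.prod_congr rfl h1, prod_range_partial_prod, h2,
      mul_left_comm, ← Finset.prod_mul_distrib, Finset.prod_eq_one, mul_one]
    intro i hi
    rw [← mul_pow, mul_inv_cancel₀ (ht i (by simpa using hi)), one_pow]
  have hsize : m ^ 2 * ℓ = m * ℓ * m := by ring
  rw [hsize]
  have hm0 : 0 < m := by omega
  have hn0 : 0 < m * ℓ * m := by positivity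
  have hy : ∀ i, x (i % (m * ℓ * m)) = u ^ (i / m) * x (i % m) := by
    intro i
    have hmod : i % (m * ℓ * m) = i / m % (m * ℓ) * m + i % m := by
      rw [mul_comm (m * ℓ) m, Nat.mod_mul]
      ring
    rw [hmod, hx _ (Nat.mod_lt _ hN) _ (Nat.mod_lt _ hm0), ← pow_mod_orderOf u (i / m),
      ← hprim.eq_orderOf]
  refine ⟨fun d hd hdn => ?_, ?_⟩
  · refine sum_prod_consecutive_eq_zero (y := fun i => x (i % (m * ℓ * m))) hprim hℓ
      (fun i => ?_) (fun i => ?_) hd (by omega)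
    · simp only [hy]
      rw [Nat.add_div_right _ hm0, Nat.add_mod_right, pow_succ]
      ring
    · simp only [hy]
      exact mul_ne_zero (pow_ne_zero _ hu0) (hx0 _ (Nat.mod_lt _ hm0))
  · rw [prod_range_mul_blocks]
    have hk : ∀ k ∈ Finset.range (m * ℓ),
        ∏ j ∈ Finset.range m, x (k * m + j) = (u ^ m) ^ k * γ := fun k hk => by
      rw [Finset.prod_congr rfl fun j hj =>
        hx k (Finset.mem_range.mp hk) j (Finset.mem_range.mp hj), Finset.prod_mul_distrib, hblock,
        Finset.prod_const, Finset.card_range, pow_right_comm]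
    rw [Finset.prod_congr rfl hk, Finset.prod_mul_distrib, Finset.prod_pow_eq_pow_sum,
      Finset.prod_const, Finset.card_range, hu, hγ]
    exact_mod_cast exp_pow_mul_exp_pow_eq_one hN hβ
end

section
/- Let m ≥ 2 and ℓ ≥ 1 be integers, n = m²ℓ, and u = exp(2πi/(mℓ)). Suppose x ∈ ℂⁿ satisfies the quasi-periodicity condition x_{(a+m) mod n} = u · x_a for every index a (equivalently, x_{km+j} = u^k y_j for some y_0, …, y_{m−1} ∈ ℂ and all k = 0, …, mℓ−1, j = 0, …, m−1). Then f_d(x) = 0 for every d with 1 ≤ d ≤ n−1 such that mℓ does not divide d. -/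
/-- The sum of an `n`-periodic function over a full period is invariant under shifts. -/
theorem Function.Periodic.sum_range_add {M : Type*} [AddCommGroup M] {g : ℕ → M} {n : ℕ}
    (hg : Function.Periodic g n) (k : ℕ) :
    ∑ i ∈ Finset.range n, g (i + k) = ∑ i ∈ Finset.range n, g i := by
  induction k with
  | zero => simp
  | succ k ih =>
    rw [← ih]
    have h := Finset.sum_range_succ' (fun i => g (i + k)) n
    rw [Finset.sum_range_succ, zero_add, add_comm n k, hg k] at h
    simpa only [add_assoc, add_comm 1 k] using (add_right_cancel h).symm

/-- If `x ∈ ℂⁿ` (with `n = m²ℓ`) is quasi-periodic, `x_{(a+m) mod n} = u·x_a`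
with `u = exp(2πi/(mℓ))`, then `f_d(x) = 0` for every `1 ≤ d ≤ n-1`
such that `mℓ` does not divide `d`. -/
theorem quasi_periodic_vanishing
    (m ℓ : ℕ) (hm : 2 ≤ m) (hℓ : 1 ≤ ℓ)
    (n : ℕ) (hn : n = m ^ 2 * ℓ)
    (u : ℂ) (hu : u = Complex.exp (2 * Real.pi * Complex.I / (m * ℓ)))
    (x : ℕ → ℂ)
    (hqp : ∀ a < n, x ((a + m) % n) = u * x a)
    (d : ℕ) (hd1 : 1 ≤ d) (hd2 : d ≤ n - 1) (hnd : ¬ (m * ℓ ∣ d)) :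
    cyclicF n d x = 0 := by
  have hprim : IsPrimitiveRoot u (m * ℓ) := by
    have h := Complex.isPrimitiveRoot_exp (m * ℓ) (by positivity)
    rw [hu]
    simpa only [Nat.cast_mul] using h
  have hud : u ^ d ≠ 1 := fun h => hnd (hprim.dvd_of_pow_eq_one d h)
  have hn0 : 0 < n := by rw [hn]; positivity
  have hx (a : ℕ) : x ((a + m) % n) = u * x (a % n) := by
    rw [← hqp (a % n) (Nat.mod_lt a hn0), Nat.mod_add_mod]
  have hper : Function.Periodic (fun i => ∏ j ∈ Finset.range d, x ((i + j) % n)) n := by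
    intro i
    simp only [add_right_comm i n, Nat.add_mod_right]
  have hshift : u ^ d * cyclicF n d x = cyclicF n d x := by
    unfold cyclicF
    refine Eq.trans ?_ (hper.sum_range_add m)
    simp only [Finset.mul_sum, add_right_comm _ m, hx, Finset.prod_mul_distrib, Finset.prod_const,
      Finset.card_range]
  by_contra hF
  exact hud (mul_right_cancel₀ hF (hshift.trans (one_mul _).symm))
end

section
/- For every nonzero complex number t, the point (t, −t^{−1}, it, −i t^{−1}, −t, t^{−1}, −i t, i t^{−1}) in ℂ⁸, where i is the imaginary unit, is a cyclic 8-root, i.e., it satisfies all eight equations of the cyclic 8-roots system. -/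
/-- For every nonzero `t ∈ ℂ`, the point
`(t, -t⁻¹, it, -it⁻¹, -t, t⁻¹, -it, it⁻¹)` is a cyclic 8-root. -/
theorem cyclic8_solution_curve (t : ℂ) (ht : t ≠ 0) (x : ℕ → ℂ)
    (h0 : x 0 = t)
    (h1 : x 1 = -t⁻¹)
    (h2 : x 2 = Complex.I * t)
    (h3 : x 3 = -Complex.I * t⁻¹)
    (h4 : x 4 = -t)
    (h5 : x 5 = t⁻¹)
    (h6 : x 6 = -Complex.I * t)
    (h7 : x 7 = Complex.I * t⁻¹) :
    IsCyclicRoot 8 x := by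
  have hts : t * t⁻¹ = 1 := mul_inv_cancel₀ ht
  have hI : Complex.I ^ 2 = -1 := Complex.I_sq
  generalize t⁻¹ = s at *
  generalize Complex.I = I at *
  refine ⟨fun d hd hd' => ?_, ?_⟩
  · interval_cases d <;>
      simp only [cyclicF, Finset.sum_range_succ, Finset.prod_range_succ, Finset.sum_range_zero,
        Finset.prod_range_zero, Nat.reduceAdd, Nat.reduceMod, h0, h1, h2, h3, h4, h5, h6, h7] <;>
      grind
  · simp only [Finset.prod_range_succ, Finset.prod_range_zero, h0, h1, h2, h3, h4, h5, h6, h7]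
    grind
end

section
/- Let A_1, …, A_N be finite nonempty subsets of ℤⁿ, regarded as subsets of ℝⁿ, and let E ⊆ ℝⁿ × ℝ^{N−1} be their Cayley embedding. Then for v ∈ ℝⁿ the following are equivalent: (1) for every i = 1, …, N, the set in_v(A_i) = { a ∈ A_i : ⟨a, v⟩ = min_{b ∈ A_i} ⟨b, v⟩ } has at least two elements; (2) there exists w ∈ ℝ^{N−1} such that the set of points of E minimizing the linear functional (a, b) ↦ ⟨a, v⟩ + ⟨b, w⟩ over E contains, for every i = 1, …, N, at least two points of the part A_i × {e_{i−1}}. -/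
/-- The Cayley embedding of supports `A₁, …, A_N ⊆ ℤⁿ`:
`E = (A₁ × {0}) ∪ (A₂ × {e₁}) ∪ ⋯ ∪ (A_N × {e_{N-1}}) ⊆ ℝⁿ × ℝ^{N-1}`,
where part `i` carries the marker `ε i = e_{i-1}` (with `ε 0 = 0`). -/
def cayleyMarker (N : ℕ) (i : Fin N) : Fin (N - 1) → ℝ :=
  fun k => if (k : ℕ) + 1 = (i : ℕ) then 1 else 0

def cayleyEmbedding {n N : ℕ} (A : Fin N → Finset (Fin n → ℤ)) :
    Set ((Fin n → ℝ) × (Fin (N - 1) → ℝ)) :=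
  {q | ∃ i : Fin N, ∃ p ∈ A i, q = (fun k => ((p k : ℤ) : ℝ), cayleyMarker N i)}

/-- Pairing the `i`-th marker with the vector of differences `f 0 - f (k + 1)`. -/
lemma sum_cayleyMarker_mul_sub {N : ℕ} (hN : 1 ≤ N) (f : Fin N → ℝ) (i : Fin N) :
    ∑ k : Fin (N - 1), cayleyMarker N i k *
      (f ⟨0, hN⟩ - f ⟨(k : ℕ) + 1, Nat.add_lt_of_lt_sub k.isLt⟩) = f ⟨0, hN⟩ - f i := by
  obtain ⟨i, hi⟩ := i
  cases i with
  | zero => simp [cayleyMarker]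
  | succ j =>
    rw [Finset.sum_eq_single (⟨j, by omega⟩ : Fin (N - 1))]
    · simp [cayleyMarker]
    · intro k _ hk
      have hkj : (k : ℕ) ≠ j := fun h => hk (Fin.ext h)
      simp [cayleyMarker, hkj]
    · simp

/-- `v ∈ ℝⁿ` is a pretropism (each `in_v(A_i)` has at least two elements)
if and only if for some `w ∈ ℝ^{N-1}` the face of the Cayley polytope
minimizing `(a,b) ↦ ⟨a,v⟩ + ⟨b,w⟩` contains at least two points of every
part `A_i × {e_{i-1}}` of the Cayley embedding. -/
theorem pretropism_iff_cayley_face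
    (n N : ℕ) (hN : 1 ≤ N)
    (A : Fin N → Finset (Fin n → ℤ)) (hA : ∀ i, (A i).Nonempty)
    (v : Fin n → ℝ) :
    (∀ i : Fin N,
      2 ≤ Set.ncard {a : Fin n → ℤ | a ∈ A i ∧
        ∀ b ∈ A i, (∑ k, (a k : ℝ) * v k) ≤ ∑ k, (b k : ℝ) * v k}) ↔
    (∃ w : Fin (N - 1) → ℝ, ∀ i : Fin N,
      2 ≤ Set.ncard {a : Fin n → ℤ | a ∈ A i ∧
        ((fun k => ((a k : ℤ) : ℝ)), cayleyMarker N i) ∈ cayleyEmbedding A ∧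
        ∀ q ∈ cayleyEmbedding A,
          ((∑ k, (a k : ℝ) * v k) + ∑ k, cayleyMarker N i k * w k)
            ≤ (∑ k, q.1 k * v k) + ∑ k, q.2 k * w k} ) := by
  constructor
  · intro h
    choose m hmA hm using fun i =>
      (A i).exists_min_image (fun a => ∑ k, (a k : ℝ) * v k) (hA i)
    refine ⟨fun k => (∑ l, (m ⟨0, hN⟩ l : ℝ) * v l) -
      ∑ l, (m ⟨(k : ℕ) + 1, Nat.add_lt_of_lt_sub k.isLt⟩ l : ℝ) * v l, fun i => ?_⟩
    have hw := sum_cayleyMarker_mul_sub hN fun i => ∑ l, (m i l : ℝ) * v l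
    refine (h i).trans (Set.ncard_le_ncard ?_ ((A i).finite_toSet.subset fun a ha => ha.1))
    rintro a ⟨haA, ha⟩
    refine ⟨haA, ⟨i, a, haA, rfl⟩, ?_⟩
    rintro _ ⟨j, b, hb, rfl⟩
    have hai := ha (m i) (hmA i)
    have hbj := hm j b hb
    have hi := hw i
    have hj := hw j
    dsimp only at hi hj hbj ⊢
    linarith
  · rintro ⟨w, h⟩ i
    refine (h i).trans (Set.ncard_le_ncard ?_ ((A i).finite_toSet.subset fun a ha => ha.1))
    rintro a ⟨haA, -, ha⟩
    exact ⟨haA, fun b hb => le_of_add_le_add_right (ha _ ⟨i, b, hb, rfl⟩)⟩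
end

section
/- Let ω = 1/2 + (√3/2)i, a primitive sixth root of unity. For every nonzero complex number t, the point x ∈ ℂ¹² defined by x_0 = t, x_1 = 1·t^{−1}, x_2 = (1/2 − (√3/2)i)·t, x_3 = (−1)·t^{−1}, x_4 = 1·t, x_5 = (−1/2 − (√3/2)i)·t^{−1}, x_6 = (−1)·t, x_7 = (−1)·t^{−1}, x_8 = (−1/2 + (√3/2)i)·t, x_9 = 1·t^{−1}, x_10 = (−1)·t, x_11 = (1/2 + (√3/2)i)·t^{−1}, is a cyclic 12-root. -/
/-- For every nonzero `t ∈ ℂ`, with `ω = 1/2 + (√3/2)i` a primitive sixth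
root of unity, the point
`(t, t⁻¹, ω̄t, -t⁻¹, t, (-ω)t⁻¹, -t, -t⁻¹, (-ω̄)t, t⁻¹, -t, ωt⁻¹)`
is a cyclic 12-root. -/
theorem cyclic12_solution_curve (t : ℂ) (ht : t ≠ 0)
    (ω : ℂ) (hω : ω = 1 / 2 + ((Real.sqrt 3 : ℝ) : ℂ) / 2 * Complex.I)
    (x : ℕ → ℂ)
    (h0 : x 0 = t)
    (h1 : x 1 = t⁻¹)
    (h2 : x 2 = (1 / 2 - ((Real.sqrt 3 : ℝ) : ℂ) / 2 * Complex.I) * t)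
    (h3 : x 3 = -t⁻¹)
    (h4 : x 4 = t)
    (h5 : x 5 = (-(1 / 2) - ((Real.sqrt 3 : ℝ) : ℂ) / 2 * Complex.I) * t⁻¹)
    (h6 : x 6 = -t)
    (h7 : x 7 = -t⁻¹)
    (h8 : x 8 = (-(1 / 2) + ((Real.sqrt 3 : ℝ) : ℂ) / 2 * Complex.I) * t)
    (h9 : x 9 = t⁻¹)
    (h10 : x 10 = -t)
    (h11 : x 11 = (1 / 2 + ((Real.sqrt 3 : ℝ) : ℂ) / 2 * Complex.I) * t⁻¹) :
    IsCyclicRoot 12 x := by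
  have hsq : ((Real.sqrt 3 : ℝ) : ℂ) ^ 2 = 3 := by
    rw [← Complex.ofReal_pow, Real.sq_sqrt (by norm_num)]
    norm_num
  have hω2 : ω ^ 2 = ω - 1 := by
    rw [hω]
    linear_combination (1 / 4 * Complex.I ^ 2) * hsq + 3 / 4 * Complex.I_sq
  have hts : t * t⁻¹ = 1 := mul_inv_cancel₀ ht
  replace h2 : x 2 = (1 - ω) * t := by rw [h2, hω]; ring
  replace h5 : x 5 = -ω * t⁻¹ := by rw [h5, hω]; ring
  replace h8 : x 8 = (ω - 1) * t := by rw [h8, hω]; ring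
  replace h11 : x 11 = ω * t⁻¹ := by rw [h11, hω]
  clear hω hsq
  generalize t⁻¹ = s at *
  refine ⟨fun d hd hd' => ?_, ?_⟩
  · simp only [cyclicF]
    interval_cases d <;>
      simp [Finset.sum_range_succ, Finset.prod_range_succ, h0, h1, h2, h3, h4, h5, h6, h7, h8,
        h9, h10, h11] <;> clear h0 h1 h2 h3 h4 h5 h6 h7 h8 h9 h10 h11 <;> grind
  · simp only [Finset.prod_range_succ, Finset.prod_range_zero, h0, h1, h2, h3, h4, h5, h6, h7, h8,
      h9, h10, h11]
    clear h0 h1 h2 h3 h4 h5 h6 h7 h8 h9 h10 h11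
    grind
end
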